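/- Let (R, m, k) be a commutative noetherian local ring and N a finitely generated Cohen–Macaulay R-module of dimension d with d > depth R, and set M := H^d_m(N). Then Tor_i^R(k, M) ≠ 0 for all i ≥ d; in particular the flat dimension of M is infinite. -/

import Mathlib

open CategoryTheory Opposite

noncomputable section

/-- The `n`-th Ext group of `R`-modules `X` and `M`, i.e. `Ext^n_R(X, M)`. -/
def extModule (R : Type) [CommRing R] (n : ℕ) (X M : ModuleCat R) : ModuleCat R :=
  ((Ext R (ModuleCat R) n).obj (op X)).obj M

/-- The `n`-th Tor group of `R`-modules `X` and `M`, i.e. `Tor_n^R(X, M)`. -/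
def torModule (R : Type) [CommRing R] (n : ℕ) (X M : ModuleCat R) : ModuleCat R :=
  ((Tor (ModuleCat R) n).obj X).obj M

/-- The residue field `k(p) = R_p / p R_p` at a prime ideal `p`. -/
abbrev resField (R : Type) [CommRing R] (p : Ideal R) [p.IsPrime] : Type :=
  IsLocalRing.ResidueField (Localization.AtPrime p)

/-- `depth_R M := inf{ i : Ext^i_R(k, M) ≠ 0 }`, as an extended real (`⊤ = ∞` if all vanish). -/
noncomputable def edepth (R : Type) [CommRing R] (k M : ModuleCat R) : EReal :=
  sInf {x : EReal | ∃ i : ℕ, x = (i : EReal) ∧ Nontrivial (extModule R i k M)}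

/-- `width_R M := inf{ i : Tor_i^R(k, M) ≠ 0 }`, as an extended real (`⊤ = ∞` if all vanish). -/
noncomputable def ewidth (R : Type) [CommRing R] (k M : ModuleCat R) : EReal :=
  sInf {x : EReal | ∃ i : ℕ, x = (i : EReal) ∧ Nontrivial (torModule R i k M)}

/-- `sup{ i : Ext^i_R(k, M) ≠ 0 }`, as an extended real (`⊥ = -∞` if all vanish). -/
noncomputable def extSup (R : Type) [CommRing R] (k M : ModuleCat R) : EReal :=
  sSup {x : EReal | ∃ i : ℕ, x = (i : EReal) ∧ Nontrivial (extModule R i k M)}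

/-- `sup{ i : Tor_i^R(k, M) ≠ 0 }`, as an extended real (`⊥ = -∞` if all vanish). -/
noncomputable def torSup (R : Type) [CommRing R] (k M : ModuleCat R) : EReal :=
  sSup {x : EReal | ∃ i : ℕ, x = (i : EReal) ∧ Nontrivial (torModule R i k M)}

namespace CategoryTheory.ProjectiveResolution

section
variable {C : Type*} [Category* C] [Abelian C] [HasExt C] {X Y : C}

lemma extMk_eq_zero_iff_next (P : ProjectiveResolution X) {n : ℕ} (f : P.complex.X n ⟶ Y)
    (hf : P.complex.d (n + 1) n ≫ f = 0) :
    P.extMk f (n + 1) rfl hf = 0 ↔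
      ∃ g : P.complex.X ((ComplexShape.down ℕ).next n) ⟶ Y,
        P.complex.d n ((ComplexShape.down ℕ).next n) ≫ g = f := by
  cases n with
  | succ n =>
    rw [extMk_eq_zero_iff _ _ _ _ _ n rfl]
    have h : (ComplexShape.down ℕ).next (n + 1) = n := by simp
    rw [h]
  | zero =>
    have h : P.complex.d 0 ((ComplexShape.down ℕ).next 0) = 0 := by
      rw [ChainComplex.next_nat_zero]; exact P.complex.shape _ _ (by simp)
    simp only [← P.extEquivCohomologyClass.apply_eq_iff_eq, extEquivCohomologyClass_extMk,
      extEquivCohomologyClass_zero, CochainComplex.HomComplex.CohomologyClass.mk_eq_zero_iff, h,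
      Limits.zero_comp]
    rw [CochainComplex.HomComplex.Cocycle.toSingleMk_mem_coboundaries_iff _ _ _ _ _ 1 (by simp)]
    have h1 : P.cochainComplex.d (-(0 : ℕ)) 1 = 0 := by
      apply Limits.IsZero.eq_of_tgt
      exact P.cochainComplex.isZero_of_isStrictlyLE 0 1 (by simp)
    simp only [h1, Limits.zero_comp, exists_const]
    rw [eq_comm, Preadditive.IsIso.comp_left_eq_zero, eq_comm]
end

variable {R : Type} [CommRing R] {X X' : ModuleCat.{0} R}

/-- The image of a projective resolution under `Hom(-, Y)`, in the opposite category. -/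
abbrev yonedaOp (P : ProjectiveResolution X) (Y : ModuleCat.{0} R) :
    ChainComplex (ModuleCat.{0} R)ᵒᵖ ℕ :=
  (((linearYoneda R (ModuleCat.{0} R)).obj Y).rightOp.mapHomologicalComplex _).obj P.complex

/-- The module of `n`-cocycles of `Hom(P, Y)`. -/
abbrev cocycles (P : ProjectiveResolution X) (Y : ModuleCat.{0} R) (n : ℕ) : ModuleCat.{0} R :=
  ((P.yonedaOp Y).opcycles n).unop

/-- The inclusion of cocycles into cochains. -/
def cocyclesι (P : ProjectiveResolution X) (Y : ModuleCat.{0} R) (n : ℕ) :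
    P.cocycles Y n →ₗ[R] (P.complex.X n ⟶ Y) :=
  ((P.yonedaOp Y).pOpcycles n).unop.hom

lemma exact_cocycles (P : ProjectiveResolution X) (Y : ModuleCat.{0} R) (n : ℕ)
    (f : P.complex.X n ⟶ Y) :
    P.complex.d (n + 1) n ≫ f = 0 ↔ ∃ z, P.cocyclesι Y n z = f := by
  have h := (ShortComplex.exact_of_g_is_cokernel
    (ShortComplex.mk _ _ ((P.yonedaOp Y).d_pOpcycles (n + 1) n))
    ((P.yonedaOp Y).opcyclesIsCokernel (n + 1) n (by simp))).unop
  rw [ShortComplex.ShortExact.moduleCat_exact_iff_function_exact] at h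
  exact h f

lemma cocyclesι_injective (P : ProjectiveResolution X) (Y : ModuleCat.{0} R) (n : ℕ) :
    Function.Injective (P.cocyclesι Y n) :=
  (ModuleCat.mono_iff_injective _).1 (inferInstance : Mono ((P.yonedaOp Y).pOpcycles n).unop)

/-- The cohomology class in derived `Ext` of a cocycle. -/
def toDerivedExt (P : ProjectiveResolution X) (Y : ModuleCat.{0} R) (n : ℕ) :
    P.cocycles Y n →ₗ[R] ((Ext R (ModuleCat.{0} R) n).obj (op X)).obj Y :=
  (P.isoLeftDerivedObj ((linearYoneda R (ModuleCat.{0} R)).obj Y).rightOp n).hom.unop.hom ∘ₗ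
    ((P.yonedaOp Y).homologyι n).unop.hom

lemma toDerivedExt_surjective (P : ProjectiveResolution X) (Y : ModuleCat.{0} R) (n : ℕ) :
    Function.Surjective (P.toDerivedExt Y n) := by
  have : Mono ((P.yonedaOp Y).homologyι n) :=
    Limits.mono_of_isLimit_fork ((P.yonedaOp Y).homologyIsKernel n _ rfl)
  exact ((ModuleCat.epi_iff_surjective _).1 (inferInstance : Epi (P.isoLeftDerivedObj
    ((linearYoneda R (ModuleCat.{0} R)).obj Y).rightOp n).hom.unop)).comp
    ((ModuleCat.epi_iff_surjective _).1 (inferInstance : Epi ((P.yonedaOp Y).homologyι n).unop))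

lemma toDerivedExt_eq_zero_iff (P : ProjectiveResolution X) (Y : ModuleCat.{0} R) (n : ℕ)
    (z : P.cocycles Y n) : P.toDerivedExt Y n z = 0 ↔
      ∃ g : P.complex.X ((ComplexShape.down ℕ).next n) ⟶ Y,
        P.complex.d n ((ComplexShape.down ℕ).next n) ≫ g = P.cocyclesι Y n z := by
  have h := (ShortComplex.exact_of_f_is_kernel
    (ShortComplex.mk _ _ ((P.yonedaOp Y).homologyι_comp_fromOpcycles n _))
    ((P.yonedaOp Y).homologyIsKernel n _ rfl)).unop
  rw [ShortComplex.ShortExact.moduleCat_exact_iff_function_exact] at h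
  have e : ∀ g, P.cocyclesι Y n (((P.yonedaOp Y).fromOpcycles n
      ((ComplexShape.down ℕ).next n)).unop.hom g) =
        P.complex.d n ((ComplexShape.down ℕ).next n) ≫ g := fun g =>
    congr(($((P.yonedaOp Y).p_fromOpcycles n ((ComplexShape.down ℕ).next n))).unop.hom g)
  have h1 : P.toDerivedExt Y n z = 0 ↔ ((P.yonedaOp Y).homologyι n).unop.hom z = 0 := by
    have : Function.Injective
        (P.isoLeftDerivedObj ((linearYoneda R (ModuleCat.{0} R)).obj Y).rightOp n).hom.unop.hom :=
      (ModuleCat.mono_iff_injective _).1 (inferInstance : Mono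
        (P.isoLeftDerivedObj ((linearYoneda R (ModuleCat.{0} R)).obj Y).rightOp n).hom.unop)
    exact map_eq_zero_iff _ this
  rw [h1]
  refine (h z).trans (exists_congr fun g => ?_)
  exact (P.cocyclesι_injective Y n).eq_iff.symm.trans (by erw [e])

lemma d_cocyclesι (P : ProjectiveResolution X) (Y : ModuleCat.{0} R) (n : ℕ)
    (z : P.cocycles Y n) : P.complex.d (n + 1) n ≫ P.cocyclesι Y n z = 0 :=
  (P.exact_cocycles Y n _).2 ⟨z, rfl⟩

/-- The class in `Abelian.Ext` of a cocycle. -/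
def toAbelianExt (P : ProjectiveResolution X) (Y : ModuleCat.{0} R) (n : ℕ) :
    P.cocycles Y n →ₗ[R] Abelian.Ext X Y n where
  toFun z := P.extMk (P.cocyclesι Y n z) (n + 1) rfl (P.d_cocyclesι Y n z)
  map_add' z w := by simp [add_extMk]
  map_smul' r z := by
    rw [RingHom.id_apply, Abelian.Ext.smul_eq_comp_mk₀, extMk_comp_mk₀]
    congr 1
    simp

lemma toAbelianExt_surjective (P : ProjectiveResolution X) (Y : ModuleCat.{0} R) (n : ℕ) :
    Function.Surjective (P.toAbelianExt Y n) := fun a => by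
  obtain ⟨f, hf, rfl⟩ := P.extMk_surjective a (n + 1) rfl
  obtain ⟨z, rfl⟩ := (P.exact_cocycles Y n f).1 hf
  exact ⟨z, rfl⟩

/-- The comparison of the two models of `Ext`, through a projective resolution. -/
def extComparison (P : ProjectiveResolution X) (Y : ModuleCat.{0} R) (n : ℕ) :
    ((Ext R (ModuleCat.{0} R) n).obj (op X)).obj Y ≃ₗ[R] Abelian.Ext X Y n :=
  ((P.toDerivedExt Y n).quotKerEquivOfSurjective (P.toDerivedExt_surjective Y n)).symm ≪≫ₗ
    Submodule.quotEquivOfEq _ _ (by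
      ext z
      rw [LinearMap.mem_ker, LinearMap.mem_ker, toDerivedExt_eq_zero_iff]
      exact (P.extMk_eq_zero_iff_next _ (P.d_cocyclesι Y n z)).symm) ≪≫ₗ
    (P.toAbelianExt Y n).quotKerEquivOfSurjective (P.toAbelianExt_surjective Y n)

lemma extComparison_toDerivedExt (P : ProjectiveResolution X) (Y : ModuleCat.{0} R) (n : ℕ)
    (z : P.cocycles Y n) :
    P.extComparison Y n (P.toDerivedExt Y n z) = P.toAbelianExt Y n z := by
  have : ((P.toDerivedExt Y n).quotKerEquivOfSurjective (P.toDerivedExt_surjective Y n)).symm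
      (P.toDerivedExt Y n z) = Submodule.Quotient.mk z := by
    rw [LinearEquiv.symm_apply_eq]; rfl
  simp only [extComparison, LinearEquiv.trans_apply, this]
  rfl

lemma extComparison_naturality (P : ProjectiveResolution X) (P' : ProjectiveResolution X')
    (Y : ModuleCat.{0} R) (n : ℕ) (g : X' ⟶ X)
    (a : ((Ext R (ModuleCat.{0} R) n).obj (op X)).obj Y) :
    P'.extComparison Y n ((((Ext R (ModuleCat.{0} R) n).map g.op).app Y).hom a) =
      (Abelian.Ext.mk₀ g).comp (P.extComparison Y n a) (zero_add n) := by
  obtain ⟨z, rfl⟩ := P.toDerivedExt_surjective Y n a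
  let φ : Hom P' P g := ⟨lift g P' P, lift_commutes_zero g P' P⟩
  let ψ := (((linearYoneda R (ModuleCat.{0} R)).obj Y).rightOp.mapHomologicalComplex
    (ComplexShape.down ℕ)).map φ.hom
  let z' : P'.cocycles Y n := (HomologicalComplex.opcyclesMap ψ n).unop.hom z
  have h1 : P'.cocyclesι Y n z' = φ.hom.f n ≫ P.cocyclesι Y n z :=
    congr(($(HomologicalComplex.p_opcyclesMap ψ n)).unop.hom z)
  have h2 : (((Ext R (ModuleCat.{0} R) n).map g.op).app Y).hom
      (P.toDerivedExt Y n z) = P'.toDerivedExt Y n z' := by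
    have e := isoLeftDerivedObj_hom_naturality g P' P φ.hom φ.hom_f_zero_comp_π_f_zero
      ((linearYoneda R (ModuleCat.{0} R)).obj Y).rightOp n
    have e2 := HomologicalComplex.homologyι_naturality ψ n
    have e3 := congr(($e).unop.hom (((P.yonedaOp Y).homologyι n).unop.hom z))
    refine e3.trans ?_
    exact congr((P'.isoLeftDerivedObj ((linearYoneda R (ModuleCat.{0} R)).obj Y).rightOp n).hom.unop.hom
      (($e2).unop.hom z))
  rw [h2, extComparison_toDerivedExt, extComparison_toDerivedExt]
  refine Eq.trans ?_ (mk₀_comp_extMk (P.cocyclesι Y n z) (n + 1) rfl (P.d_cocyclesι Y n z) φ).symm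
  simp only [toAbelianExt, LinearMap.coe_mk, AddHom.coe_mk, h1]

end CategoryTheory.ProjectiveResolution

/-- Duality between `Tor` and `Ext` over a field, in one direction. -/
lemma nontrivial_tor_of_nontrivial_ext {R : Type} [CommRing R] (K : Type) [Field K] [Algebra R K]
    (M : ModuleCat.{0} R) (n : ℕ) [Nontrivial (Abelian.Ext M (ModuleCat.of R K) n)] :
    Nontrivial (((Tor (ModuleCat.{0} R) n).obj (ModuleCat.of R K)).obj M) := by
  by_contra! hsub
  let P : ProjectiveResolution M := projectiveResolution M
  let T := ((MonoidalCategory.tensoringLeft (ModuleCat.{0} R)).obj (ModuleCat.of R K))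
  have hz : ((T.mapHomologicalComplex _).obj P.complex).ExactAt n := by
    rw [HomologicalComplex.exactAt_iff_isZero_homology]
    exact (@ModuleCat.isZero_of_subsingleton _ _ _ hsub).of_iso (P.isoLeftDerivedObj T n).symm
  rw [HomologicalComplex.exactAt_iff' _ (n + 1) n ((ComplexShape.down ℕ).next n) (by simp) rfl,
    ShortComplex.moduleCat_exact_iff] at hz
  obtain ⟨a, ha⟩ := exists_ne (0 : Abelian.Ext M (ModuleCat.of R K) n)
  obtain ⟨f, hf, rfl⟩ := P.extMk_surjective a (n + 1) rfl
  refine ha ((P.extMk_eq_zero_iff_next f hf).2 ?_)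
  let δ := (P.complex.d n ((ComplexShape.down ℕ).next n)).hom.baseChange K
  let f' : TensorProduct R K (P.complex.X n) →ₗ[K] K :=
    TensorProduct.AlgebraTensorModule.lift
      ((LinearMap.toSpanSingleton K (P.complex.X n →ₗ[R] K) f.hom))
  have hf' : f' ∈ δ.dualMap.range := by
    rw [LinearMap.range_dualMap_eq_dualAnnihilator_ker, Submodule.mem_dualAnnihilator]
    intro x hx
    obtain ⟨y, rfl⟩ := hz x hx
    clear hx
    change f' ((P.complex.d (n + 1) n).hom.lTensor K y) = 0
    induction y using TensorProduct.induction_on with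
    | zero => simp
    | add y z hy hz => rw [map_add, map_add, hy, hz, add_zero]
    | tmul c p =>
      have := congr($hf p)
      simp only [ModuleCat.hom_comp, LinearMap.comp_apply] at this
      simp [f', LinearMap.toSpanSingleton]
      right; exact this
  obtain ⟨h, hh⟩ := hf'
  refine ⟨ModuleCat.ofHom (h.restrictScalars R ∘ₗ TensorProduct.mk R K _ 1), ?_⟩
  ext p
  have := congr($hh ((1 : K) ⊗ₜ[R] p))
  simpa [δ, f'] using this

section LimExt

open Abelian

variable {R : Type} [CommRing R] (J : Ideal R)

/-- The projection `R ⧸ J ^ t ⟶ R ⧸ J ^ s` for `s ≤ t`. -/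
def powProj {s t : ℕ} (h : s ≤ t) : ModuleCat.of R (R ⧸ J ^ t) ⟶ ModuleCat.of R (R ⧸ J ^ s) :=
  ModuleCat.ofHom (Submodule.mapQ _ _ LinearMap.id (Ideal.pow_le_pow_right h))

lemma powProj_comp {s t u : ℕ} (h : s ≤ t) (h' : t ≤ u) :
    powProj J h' ≫ powProj J h = powProj J (h.trans h') := by
  refine ModuleCat.hom_ext (LinearMap.ext fun x => ?_)
  obtain ⟨x, rfl⟩ := Submodule.Quotient.mk_surjective _ x
  rfl

lemma powProj_refl (s : ℕ) : powProj J (le_refl s) = 𝟙 _ := by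
  refine ModuleCat.hom_ext (LinearMap.ext fun x => ?_)
  obtain ⟨x, rfl⟩ := Submodule.Quotient.mk_surjective _ x
  rfl

/-- The transition maps of the system `t ↦ Ext (R ⧸ J ^ t) N i`. -/
def powExtMap (N : ModuleCat.{0} R) (i s t : ℕ) (h : s ≤ t) :
    Ext (ModuleCat.of R (R ⧸ J ^ s)) N i →ₗ[R] Ext (ModuleCat.of R (R ⧸ J ^ t)) N i :=
  (Ext.mk₀ (powProj J h)).precompOfLinear R N (zero_add i)

lemma powExtMap_apply (N : ModuleCat.{0} R) (i s t : ℕ) (h : s ≤ t)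
    (a : Ext (ModuleCat.of R (R ⧸ J ^ s)) N i) :
    powExtMap J N i s t h a = (Ext.mk₀ (powProj J h)).comp a (zero_add i) := rfl

instance (N : ModuleCat.{0} R) (i : ℕ) : DirectedSystem
    (fun t => Ext (ModuleCat.of R (R ⧸ J ^ t)) N i) (powExtMap J N i · · ·) where
  map_self s a := by simp [powExtMap_apply, powProj_refl]
  map_map s t u h h' a := by simp [powExtMap_apply, ← powProj_comp J h h']

/-- The direct limit of `Ext (R ⧸ J ^ t) N i`, for the `Ext` groups of `Abelian.Ext`. -/
abbrev LimExt (N : ModuleCat.{0} R) (i : ℕ) : Type :=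
  Module.DirectLimit _ (powExtMap J N i)

namespace LimExt

variable {J}

/-- The canonical map to the direct limit. -/
abbrev of (N : ModuleCat.{0} R) (i t : ℕ) :
    Ext (ModuleCat.of R (R ⧸ J ^ t)) N i →ₗ[R] LimExt J N i :=
  Module.DirectLimit.of R ℕ _ (powExtMap J N i) t

/-- Postcomposition with an `Ext` class. -/
def map {N N' : ModuleCat.{0} R} {p i j : ℕ} (a : Ext N N' p) (h : i + p = j) :
    LimExt J N i →ₗ[R] LimExt J N' j :=
  Module.DirectLimit.map (fun t => a.postcompOfLinear R _ h) (by
    intro s t hst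
    ext x
    exact Ext.comp_assoc _ _ _ (zero_add i) h (by omega))

lemma map_of {N N' : ModuleCat.{0} R} {p i j : ℕ} (a : Ext N N' p) (h : i + p = j) (t : ℕ)
    (x : Ext (ModuleCat.of R (R ⧸ J ^ t)) N i) :
    map a h (of N i t x) = of N' j t (x.comp a h) :=
  Module.DirectLimit.map_apply_of _ _ _

lemma exact_map {N N' N'' : ModuleCat.{0} R} {p q i j l : ℕ} (a : Ext N N' p) (b : Ext N' N'' q)
    (h : i + p = j) (h' : j + q = l)
    (H : ∀ (X : ModuleCat.{0} R) (y : Ext X N' j), y.comp b h' = 0 ↔ ∃ x : Ext X N i, x.comp a h = y) :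
    Function.Exact (map (J := J) a h) (map b h') := by
  intro y
  obtain ⟨t, y, rfl⟩ := Module.DirectLimit.exists_of y
  constructor
  · intro hy
    rw [map_of] at hy
    obtain ⟨u, htu, hu⟩ := Module.DirectLimit.of.zero_exact hy
    rw [powExtMap_apply, ← Ext.comp_assoc (h := by omega) (h₁₂ := zero_add j)] at hu
    obtain ⟨x, hx⟩ := (H _ _).1 hu
    refine ⟨of N i u x, ?_⟩
    rw [map_of, hx]
    exact Module.DirectLimit.of_f (f := powExtMap J N' j)
  · rintro ⟨x, hx⟩
    obtain ⟨s, x, rfl⟩ := Module.DirectLimit.exists_of x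
    rw [← hx, map_of, map_of, (H _ _).2 ⟨x, rfl⟩, map_zero]

lemma map_smul_id (N : ModuleCat.{0} R) (i : ℕ) (r : R) (x : LimExt J N i) :
    map (Ext.mk₀ (r • 𝟙 N)) (add_zero i) x = r • x := by
  obtain ⟨t, x, rfl⟩ := Module.DirectLimit.exists_of x
  rw [map_of, ← Ext.smul_eq_comp_mk₀, map_smul]

lemma exists_pow_smul_eq_zero {N : ModuleCat.{0} R} {i : ℕ} (x : LimExt J N i) :
    ∃ t, ∀ r ∈ J ^ t, r • x = 0 := by
  obtain ⟨t, x, rfl⟩ := Module.DirectLimit.exists_of x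
  refine ⟨t, fun r hr => ?_⟩
  have h0 : r • 𝟙 (ModuleCat.of R (R ⧸ J ^ t)) = 0 := by
    refine ModuleCat.hom_ext (LinearMap.ext fun y => ?_)
    obtain ⟨y, rfl⟩ := Submodule.Quotient.mk_surjective _ y
    refine (Submodule.Quotient.mk_eq_zero _).2 (Ideal.mul_mem_right _ _ hr)
  have : r • x = 0 := by
    rw [← Ext.mk₀_id_comp x, ← Ext.smul_comp, ← Ext.mk₀_smul, h0, Ext.mk₀_zero, Ext.zero_comp]
  rw [← map_smul, this, map_zero]

section ShortExact

variable {S : ShortComplex (ModuleCat.{0} R)} (hS : S.ShortExact)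
include hS

lemma exact₁ {i j : ℕ} (h : i + 1 = j) :
    Function.Exact (map (J := J) hS.extClass h) (map (Ext.mk₀ S.f) (add_zero j)) :=
  exact_map _ _ _ _ fun X y => ⟨fun hy => by
    subst h; exact Ext.covariant_sequence_exact₁ X hS y hy rfl, by
    rintro ⟨x, rfl⟩; simp⟩

lemma exact₂ (i : ℕ) :
    Function.Exact (map (J := J) (Ext.mk₀ S.f) (add_zero i)) (map (Ext.mk₀ S.g) (add_zero i)) :=
  exact_map _ _ _ _ fun X y => ⟨Ext.covariant_sequence_exact₂ X hS y, by
    rintro ⟨x, rfl⟩; simp⟩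

lemma exact₃ {i j : ℕ} (h : i + 1 = j) :
    Function.Exact (map (J := J) (Ext.mk₀ S.g) (add_zero i)) (map hS.extClass h) :=
  exact_map _ _ _ _ fun X y => ⟨fun hy => Ext.covariant_sequence_exact₃ X hS y h hy, by
    rintro ⟨x, rfl⟩; simp⟩

end ShortExact

end LimExt

/-- Local cohomology as a direct limit of `Abelian.Ext` groups. -/
def limExtEquivLocalCohomology (N : ModuleCat.{0} R) (i : ℕ) :
    LimExt J N i ≃ₗ[R] (localCohomology J i).obj N := by
  let D := localCohomology.diagram (localCohomology.idealPowersDiagram J) i ⋙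
    (evaluation (ModuleCat.{0} R) (ModuleCat.{0} R)).obj N
  let e : (localCohomology J i).obj N ≅ Limits.colimit D :=
    Limits.colimitObjIsoColimitCompEvaluation _ N
  let c (t : ℕ) : D.obj (op (op t)) ≃ₗ[R] Ext (ModuleCat.of R (R ⧸ J ^ t)) N i :=
    (projectiveResolution (ModuleCat.of R (R ⧸ J ^ t))).extComparison N i
  have hc (s t : ℕ) (h : s ≤ t) (x : D.obj (op (op s))) :
      c t ((D.map (homOfLE h).op.op).hom x) = powExtMap J N i s t h (c s x) :=
    (projectiveResolution (ModuleCat.of R (R ⧸ J ^ s))).extComparison_naturality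
      (projectiveResolution (ModuleCat.of R (R ⧸ J ^ t))) N i (powProj J h) x
  let φ : LimExt J N i →ₗ[R] (Limits.colimit D : ModuleCat.{0} R) :=
    Module.DirectLimit.lift R ℕ _ _ (fun t => (Limits.colimit.ι D (op (op t))).hom ∘ₗ (c t).symm)
      (by
        intro s t h x
        obtain ⟨x, rfl⟩ := (c s).surjective x
        simp only [LinearMap.comp_apply, LinearEquiv.coe_coe, ← hc, LinearEquiv.symm_apply_apply]
        exact congr(($(Limits.colimit.w D (homOfLE h).op.op)).hom x))
  have hφ (t : ℕ) (x : Ext (ModuleCat.of R (R ⧸ J ^ t)) N i) :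
      φ (LimExt.of N i t x) = (Limits.colimit.ι D (op (op t))).hom ((c t).symm x) :=
    Module.DirectLimit.lift_of _ _ _
  refine (LinearEquiv.ofBijective φ ⟨?_, ?_⟩).trans e.toLinearEquiv.symm
  · rw [injective_iff_map_eq_zero]
    intro x hx
    obtain ⟨t, x, rfl⟩ := Module.DirectLimit.exists_of x
    rw [hφ, ← map_zero (Limits.colimit.ι D (op (op t))).hom] at hx
    obtain ⟨u, f, g, h⟩ := Limits.Concrete.colimit_exists_of_rep_eq D _ _ hx
    have htu : t ≤ u.unop.unop := f.unop.unop.down.down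
    have h' := hc _ _ htu ((c t).symm x)
    rw [LinearEquiv.apply_symm_apply] at h'
    have h2 : (D.map (homOfLE htu).op.op).hom ((c t).symm x) = 0 := by
      refine Eq.trans h ?_
      exact map_zero (D.map g).hom
    rw [h2, map_zero] at h'
    rw [← Module.DirectLimit.of_f (hij := htu), ← h', map_zero]
  · intro y
    obtain ⟨t, y, rfl⟩ := Limits.Concrete.colimit_exists_rep D y
    exact ⟨LimExt.of N i t.unop.unop (c _ y), by rw [hφ, LinearEquiv.symm_apply_apply]⟩

end LimExt

section LimExt

open Abelian

variable {R : Type} [CommRing R] {J : Ideal R}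

namespace LimExt

/-- If `N` is killed by a power of `J` then its zeroth local cohomology is `N`. -/
lemma nonempty_equiv_of_pow_smul_eq_zero (N : ModuleCat.{0} R) {s : ℕ}
    (hs : ∀ r ∈ J ^ s, ∀ n : N, r • n = 0) : Nonempty (LimExt J N 0 ≃ₗ[R] N) := by
  let ev (t : ℕ) : Ext (ModuleCat.of R (R ⧸ J ^ t)) N 0 →ₗ[R] N :=
    LinearMap.applyₗ (Submodule.Quotient.mk (1 : R)) ∘ₗ
      (Ext.linearEquiv₀.trans ModuleCat.homLinearEquiv).toLinearMap
  have ev_mk (t : ℕ) (f : ModuleCat.of R (R ⧸ J ^ t) ⟶ N) :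
      ev t (Ext.mk₀ f) = f.hom (Submodule.Quotient.mk (1 : R)) := by
    have : Ext.linearEquiv₀ (R := R) (Ext.mk₀ f) = f := Ext.homEquiv₀.right_inv f
    simp only [ev, LinearMap.comp_apply, LinearEquiv.coe_coe, LinearEquiv.trans_apply, this]
    rfl
  have hcomp (i j : ℕ) (hij : i ≤ j) (x : Ext (ModuleCat.of R (R ⧸ J ^ i)) N 0) :
      ev j (powExtMap J N 0 i j hij x) = ev i x := by
    obtain ⟨f, rfl⟩ := (Ext.mk₀_bijective _ _).2 x
    rw [powExtMap_apply, Ext.mk₀_comp_mk₀, ev_mk, ev_mk]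
    rfl
  refine ⟨LinearEquiv.ofBijective (Module.DirectLimit.lift R ℕ _ _ ev hcomp)
    ⟨Module.DirectLimit.lift_injective _ _ fun t => ?_, fun n => ?_⟩⟩
  · rw [injective_iff_map_eq_zero]
    intro x hx
    obtain ⟨f, rfl⟩ := (Ext.mk₀_bijective _ _).2 x
    rw [ev_mk] at hx
    rw [Ext.mk₀_eq_zero_iff]
    refine ModuleCat.hom_ext (LinearMap.ext fun y => ?_)
    obtain ⟨y, rfl⟩ := Submodule.Quotient.mk_surjective _ y
    have : (Submodule.Quotient.mk y : R ⧸ J ^ t) = y • Submodule.Quotient.mk (1 : R) := by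
      rw [← Submodule.Quotient.mk_smul, smul_eq_mul, mul_one]
    rw [this, map_smul, hx, smul_zero]
    rfl
  · let f : ModuleCat.of R (R ⧸ J ^ s) ⟶ N := ModuleCat.ofHom
      (Submodule.liftQ _ (LinearMap.toSpanSingleton R N n) fun r hr => hs r hr n)
    refine ⟨of N 0 s (Ext.mk₀ f), ?_⟩
    rw [Module.DirectLimit.lift_of, ev_mk]
    exact one_smul R n

/-- If `N` is killed by a power of `J` then its first local cohomology vanishes. -/
lemma subsingleton_one_of_pow_smul_eq_zero (N : ModuleCat.{0} R) {s : ℕ}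
    (hs : ∀ r ∈ J ^ s, ∀ n : N, r • n = 0) : Subsingleton (LimExt J N 1) := by
  refine subsingleton_of_forall_eq 0 fun x => ?_
  obtain ⟨t, y, rfl⟩ := Module.DirectLimit.exists_of x
  let S (t : ℕ) := (Submodule.mkQ (J ^ t)).shortComplexKer
  have hS (t : ℕ) : (S t).ShortExact :=
    LinearMap.shortExact_shortComplexKer (Submodule.mkQ_surjective (J ^ t))
  have : Projective (S t).X₂ := ModuleCat.projective_of_free (Module.Basis.singleton Unit R)
  obtain ⟨x₁, hx₁⟩ := Ext.contravariant_sequence_exact₃ (hS t) N y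
    (Ext.eq_zero_of_projective _) (add_zero 1)
  obtain ⟨f, rfl⟩ := (Ext.mk₀_bijective _ _).2 x₁
  have hle : J ^ (s + t) ≤ J ^ t := Ideal.pow_le_pow_right (by omega)
  have hker (t : ℕ) : LinearMap.ker (Submodule.mkQ (J ^ t)) = J ^ t := Submodule.ker_mkQ _
  let φ : S (s + t) ⟶ S t :=
    { τ₁ := ModuleCat.ofHom (Submodule.inclusion (by rw [hker, hker]; exact hle))
      τ₂ := 𝟙 _
      τ₃ := powProj J (by omega : t ≤ s + t)
      comm₁₂ := rfl
      comm₂₃ := rfl }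
  have h0 : φ.τ₁ ≫ f = 0 := by
    have key (r : R) (hr : r ∈ J ^ (s + t)) :
        ∀ h : r ∈ LinearMap.ker (Submodule.mkQ (J ^ t)), f.hom ⟨r, h⟩ = 0 := by
      rw [pow_add] at hr
      induction hr using Submodule.mul_induction_on' with
      | mem_mul_mem a ha b hb =>
        intro h
        rw [← hs a ha (f.hom ⟨b, by rwa [hker]⟩), ← map_smul]
        rfl
      | add a ha b hb h1 h2 =>
        intro h
        have ha' := Ideal.mul_le_right ha
        have hb' := Ideal.mul_le_right hb
        refine (map_add f.hom ⟨a, by rwa [hker]⟩ ⟨b, by rwa [hker]⟩).trans ?_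
        rw [h1, h2, add_zero]
    refine ModuleCat.hom_ext (LinearMap.ext fun y => key y.1 ?_ _)
    exact (hker (s + t)).le y.2
  have hy : powExtMap J N 1 t (s + t) (by omega) y = 0 := by
    rw [powExtMap_apply, ← hx₁, ← Ext.comp_assoc (h := by omega) (h₁₂ := zero_add 1)]
    have e := ShortComplex.ShortExact.extClass_naturality (hS (s + t)) (hS t) φ
    refine (congrArg (fun z => Ext.comp z (Ext.mk₀ f) (add_zero 1)) e.symm).trans ?_
    rw [Ext.comp_assoc (h := by omega) (h₂₃ := add_zero 0), Ext.mk₀_comp_mk₀, h0, Ext.mk₀_zero,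
      Ext.comp_zero]
  rw [← Module.DirectLimit.of_f (hij := (by omega : t ≤ s + t)), hy, map_zero]

end LimExt

end LimExt

section BassLength

open Abelian IsLocalRing

variable {R : Type} [CommRing R]

section

variable {S : ShortComplex (ModuleCat.{0} R)} (hS : S.ShortExact) (K : ModuleCat.{0} R)
include hS

/-- The length of `Ext` from the third term when the first map induces zero. -/
lemma length_ext_of_precomp_f_eq_zero
    (h0 : ∀ i (y : Ext S.X₂ K i), (Ext.mk₀ S.f).comp y (zero_add i) = 0) (i : ℕ) :
    Module.length R (Ext S.X₃ K (i + 1)) =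
      Module.length R (Ext S.X₁ K i) + Module.length R (Ext S.X₂ K (i + 1)) := by
  refine Module.length_eq_add_of_exact (hS.extClass.precompOfLinear R K (add_comm 1 i))
    ((Ext.mk₀ S.g).precompOfLinear R K (zero_add (i + 1))) ?_ ?_ ?_
  · rw [injective_iff_map_eq_zero]
    intro x hx
    obtain ⟨y, rfl⟩ := Ext.contravariant_sequence_exact₁ hS K x (add_comm 1 i) hx
    exact h0 i y
  · intro x
    exact Ext.contravariant_sequence_exact₂ hS K x (h0 _ x)
  · intro x
    refine ⟨fun h => Ext.contravariant_sequence_exact₃ hS K x h (add_comm 1 i), ?_⟩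
    rintro ⟨y, rfl⟩
    exact hS.comp_extClass_assoc y (add_comm 1 i)

lemma length_ext_zero_of_precomp_f_eq_zero
    (h0 : ∀ y : Ext S.X₂ K 0, (Ext.mk₀ S.f).comp y (zero_add 0) = 0) :
    Module.length R (Ext S.X₃ K 0) = Module.length R (Ext S.X₂ K 0) := by
  refine (LinearEquiv.ofBijective ((Ext.mk₀ S.g).precompOfLinear R K (zero_add 0))
    ⟨?_, fun x => Ext.contravariant_sequence_exact₂ hS K x (h0 x)⟩).length_eq
  rw [injective_iff_map_eq_zero]
  intro x hx
  have := hS.epi_g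
  obtain ⟨f, rfl⟩ := (Ext.mk₀_bijective _ _).2 x
  change (Ext.mk₀ S.g).comp (Ext.mk₀ f) (zero_add 0) = 0 at hx
  rw [Ext.mk₀_comp_mk₀, Ext.mk₀_eq_zero_iff] at hx
  rw [Ext.mk₀_eq_zero_iff, ← cancel_epi S.g, hx, Limits.comp_zero]

/-- The length of `Ext` from the first term when the second map induces zero. -/
lemma length_ext_of_precomp_g_eq_zero
    (h0 : ∀ i (y : Ext S.X₃ K i), (Ext.mk₀ S.g).comp y (zero_add i) = 0) (i : ℕ) :
    Module.length R (Ext S.X₁ K i) =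
      Module.length R (Ext S.X₂ K i) + Module.length R (Ext S.X₃ K (i + 1)) := by
  refine Module.length_eq_add_of_exact ((Ext.mk₀ S.f).precompOfLinear R K (zero_add i))
    (hS.extClass.precompOfLinear R K (add_comm 1 i)) ?_ ?_ ?_
  · rw [injective_iff_map_eq_zero]
    intro x hx
    obtain ⟨y, rfl⟩ := Ext.contravariant_sequence_exact₂ hS K x hx
    exact h0 i y
  · intro x
    exact Ext.contravariant_sequence_exact₃ hS K x (h0 _ x) (add_comm 1 i)
  · intro x
    refine ⟨Ext.contravariant_sequence_exact₁ hS K x (add_comm 1 i), ?_⟩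
    rintro ⟨y, rfl⟩
    exact hS.extClass_comp_assoc y (h := add_comm 1 i)

end

/-- Isomorphic objects have isomorphic contravariant `Ext` modules. -/
def extEquivOfIso {X Y : ModuleCat.{0} R} (ι : X ≅ Y) (K : ModuleCat.{0} R) (i : ℕ) :
    Ext X K i ≃ₗ[R] Ext Y K i :=
  LinearEquiv.ofLinearMap ((Ext.mk₀ ι.inv).precompOfLinear R K (zero_add i))
    ((Ext.mk₀ ι.hom).precompOfLinear R K (zero_add i))
    (LinearMap.ext fun y => by
      change (Ext.mk₀ ι.inv).comp ((Ext.mk₀ ι.hom).comp y (zero_add i)) (zero_add i) = y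
      rw [Ext.mk₀_comp_mk₀_assoc, ι.inv_hom_id, Ext.mk₀_id_comp])
    (LinearMap.ext fun y => by
      change (Ext.mk₀ ι.hom).comp ((Ext.mk₀ ι.inv).comp y (zero_add i)) (zero_add i) = y
      rw [Ext.mk₀_comp_mk₀_assoc, ι.hom_inv_id, Ext.mk₀_id_comp])

variable [IsLocalRing R]

/-- The residue field as an object of the category of modules. -/
abbrev resMod (R : Type) [CommRing R] [IsLocalRing R] : ModuleCat.{0} R :=
  ModuleCat.of R (ResidueField R)

lemma smul_id_resMod {r : R} (hr : r ∈ maximalIdeal R) : r • 𝟙 (resMod R) = 0 := by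
  refine ModuleCat.hom_ext (LinearMap.ext fun (y : ResidueField R) => ?_)
  change r • y = 0
  rw [Algebra.smul_def, ResidueField.algebraMap_eq, (residue_eq_zero_iff r).2 hr, zero_mul]

lemma smul_ext_resMod {X : ModuleCat.{0} R} {i : ℕ} {r : R} (hr : r ∈ maximalIdeal R)
    (y : Ext X (resMod R) i) : r • y = 0 := by
  rw [Ext.smul_eq_comp_mk₀, smul_id_resMod hr, Ext.mk₀_zero, Ext.comp_zero]

lemma smul_ext_from_resMod {X : ModuleCat.{0} R} {i : ℕ} {r : R} (hr : r ∈ maximalIdeal R)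
    (y : Ext (resMod R) X i) : r • y = 0 := by
  rw [← Ext.mk₀_id_comp y, ← Ext.smul_comp, ← Ext.mk₀_smul, smul_id_resMod hr, Ext.mk₀_zero,
    Ext.zero_comp]

lemma smul_id_precomp_ext_resMod {X : ModuleCat.{0} R} {i : ℕ} {r : R} (hr : r ∈ maximalIdeal R)
    (y : Ext X (resMod R) i) : (Ext.mk₀ (r • 𝟙 X)).comp y (zero_add i) = 0 := by
  rw [Ext.mk₀_smul, Ext.smul_comp, smul_ext_resMod hr]

lemma length_ne_top_of_smul_eq_zero {E : Type*} [AddCommGroup E] [Module R E] [Module.Finite R E]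
    (h : ∀ r ∈ maximalIdeal R, ∀ e : E, r • e = 0) : Module.length R E ≠ ⊤ := by
  let : Field (R ⧸ maximalIdeal R) := Ideal.Quotient.field _
  have ht : Module.IsTorsionBySet R E (maximalIdeal R) := fun e r => h r r.2 e
  let := ht.module
  have : IsScalarTower R (R ⧸ maximalIdeal R) E := ht.isScalarTower
  have : Module.Finite (R ⧸ maximalIdeal R) E := Module.Finite.of_restrictScalars_finite R _ _
  rw [Module.length_eq_of_surjective (R := R ⧸ maximalIdeal R) Ideal.Quotient.mk_surjective,
    Module.length_eq_finrank]
  exact ENat.natCast_ne_top _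

lemma length_ext_resMod_ne_top [IsNoetherianRing R] (X : ModuleCat.{0} R) [Module.Finite R X]
    (i : ℕ) : Module.length R (Ext X (resMod R) i) ≠ ⊤ :=
  length_ne_top_of_smul_eq_zero fun _ hr => smul_ext_resMod hr

end BassLength

section CohenMacaulay

open Abelian IsLocalRing RingTheory.Sequence

variable {R : Type} [CommRing R]

namespace LimExt

lemma map_extClass_injective {J : Ideal R} {S : ShortComplex (ModuleCat.{0} R)}
    (hS : S.ShortExact) {i j : ℕ} (h : i + 1 = j) (h2 : Subsingleton (LimExt J S.X₂ i)) :
    Function.Injective (map (J := J) hS.extClass h) := by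
  rw [injective_iff_map_eq_zero]
  intro y hy
  obtain ⟨z, rfl⟩ := (exact₃ hS h y).1 hy
  rw [Subsingleton.elim z 0, map_zero]

lemma exact_map_extClass_smul {J : Ideal R} {N : Type} [AddCommGroup N] [Module R N] {x : R}
    (hreg : IsSMulRegular N x) (i : ℕ) :
    Function.Exact (map (J := J) (IsSMulRegular.smulShortComplex_shortExact
      (M := ModuleCat.of R N) hreg).extClass (rfl : i + 1 = i + 1)) (fun y => x • y) := by
  have h := exact₁ (J := J) (IsSMulRegular.smulShortComplex_shortExact (M := ModuleCat.of R N) hreg)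
    (rfl : i + 1 = i + 1)
  rw [ModuleCat.smulShortComplex_f_eq_smul_id] at h
  intro y
  exact Iff.trans (Eq.congr_left (map_smul_id (ModuleCat.of R N) (i + 1) x y).symm) (h y)

lemma smul_surjective_of_subsingleton {J : Ideal R} {N : Type} [AddCommGroup N] [Module R N]
    {x : R} (hreg : IsSMulRegular N x) (i : ℕ)
    [Subsingleton (LimExt J (ModuleCat.of R (QuotSMulTop x N)) i)] :
    Function.Surjective fun y : LimExt J (ModuleCat.of R N) i => x • y := by
  have h := exact₂ (J := J) (IsSMulRegular.smulShortComplex_shortExact (M := ModuleCat.of R N) hreg)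
    i
  rw [ModuleCat.smulShortComplex_f_eq_smul_id] at h
  intro y
  obtain ⟨z, hz⟩ := (h y).1 (Subsingleton.elim
    (α := LimExt J (ModuleCat.of R (QuotSMulTop x N)) i) _ _)
  exact ⟨z, (map_smul_id _ _ _ _).symm.trans hz⟩

lemma exists_shortExact_smul {A B : Type} [AddCommGroup A] [Module R A] [AddCommGroup B]
    [Module R B] {x : R} (f : A →ₗ[R] B) (hf : Function.Injective f)
    (hex : Function.Exact f fun y => x • y) (hx : Function.Surjective fun y : B => x • y) :
    ∃ (f : ModuleCat.of R A ⟶ ModuleCat.of R B) (w : f ≫ (x • 𝟙 (ModuleCat.of R B)) = 0),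
      (ShortComplex.mk f (x • 𝟙 (ModuleCat.of R B)) w).ShortExact :=
  ⟨ModuleCat.ofHom f, ModuleCat.hom_ext (LinearMap.ext hex.apply_apply_eq_zero),
    { exact := (ShortComplex.ShortExact.moduleCat_exact_iff_function_exact _).2 hex
      mono_f := (ModuleCat.mono_iff_injective _).2 hf
      epi_g := (ModuleCat.epi_iff_surjective _).2 hx }⟩

lemma smul_injective_of_subsingleton {N : Type} [AddCommGroup N] [Module R N] {x : R}
    (hreg : IsSMulRegular N x) {i : ℕ} {J : Ideal R}
    [Subsingleton (LimExt J (ModuleCat.of R (QuotSMulTop x N)) i)] :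
    IsSMulRegular (LimExt J (ModuleCat.of R N) (i + 1)) x := by
  have hS := IsSMulRegular.smulShortComplex_shortExact (M := ModuleCat.of R N) hreg
  rw [isSMulRegular_iff_right_eq_zero_of_smul]
  intro y hy
  obtain ⟨z, rfl⟩ := (exact₁ (J := J) hS (rfl : i + 1 = i + 1) y).1 (by
    rw [ModuleCat.smulShortComplex_f_eq_smul_id]
    exact (map_smul_id _ _ _ _).trans hy)
  have : z = 0 := Subsingleton.elim (α := LimExt J (ModuleCat.of R (QuotSMulTop x N)) i) z 0
  subst this
  exact map_zero _

lemma subsingleton_of_isSMulRegular {N : ModuleCat.{0} R} {x : R} {J : Ideal R} (hx : x ∈ J)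
    {i : ℕ} (h : IsSMulRegular (LimExt J N i) x) : Subsingleton (LimExt J N i) := by
  refine subsingleton_of_forall_eq 0 fun y => ?_
  obtain ⟨t, ht⟩ := exists_pow_smul_eq_zero y
  exact (h.pow t).right_eq_zero_of_smul (ht _ (Ideal.pow_mem_pow hx t))

end LimExt

variable [IsLocalRing R]

lemma maximalIdeal_smul_top_lt (N : Type) [AddCommGroup N] [Module R N] [Module.Finite R N]
    [Nontrivial N] : maximalIdeal R • (⊤ : Submodule R N) < ⊤ := by
  refine (Submodule.top_ne_ideal_smul_of_le_jacobson_annihilator ?_).symm.lt_top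
  exact (maximalIdeal_le_jacobson _)

variable [IsNoetherianRing R]

lemma exists_pow_smul_eq_zero_of_supportDim_eq_zero (N : Type) [AddCommGroup N] [Module R N]
    [Module.Finite R N] (h : Module.supportDim R N = 0) :
    ∃ s, ∀ r ∈ maximalIdeal R ^ s, ∀ n : N, r • n = 0 := by
  have h1 := support_of_supportDim_eq_zero R N h
  rw [Module.support_eq_zeroLocus, PrimeSpectrum.zeroLocus_eq_iff] at h1
  obtain ⟨s, hs⟩ := Ideal.exists_pow_le_of_le_radical_of_fg
    (Ideal.le_radical.trans h1.ge) (IsNoetherian.noetherian (maximalIdeal R))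
  exact ⟨s, fun r hr n => Module.mem_annihilator.1 (hs hr) n⟩

lemma supportDim_quotSMulTop_of_eq_succ {N : Type} [AddCommGroup N] [Module R N]
    [Module.Finite R N] {x : R} (hx : x ∈ maximalIdeal R) (hreg : IsSMulRegular N x) {n : ℕ}
    (hdim : Module.supportDim R N = ((n + 1 : ℕ) : WithBot ℕ∞)) :
    Module.supportDim R (QuotSMulTop x N) = (n : WithBot ℕ∞) := by
  rw [← Module.supportDim_quotSMulTop_succ_eq_supportDim hreg hx, Nat.cast_add, Nat.cast_one]
    at hdim
  exact ENat.WithBot.add_one_cancel.1 hdim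

namespace LimExt

/-- The local cohomology of a Cohen–Macaulay module vanishes just above its dimension. -/
lemma subsingleton_succ (rs : List R) : ∀ (N : Type) [AddCommGroup N] [Module R N]
    [Module.Finite R N], (∀ r ∈ rs, r ∈ maximalIdeal R) → IsRegular N rs →
    Module.supportDim R N = (rs.length : WithBot ℕ∞) →
    Subsingleton (LimExt (maximalIdeal R) (ModuleCat.of R N) (rs.length + 1)) := by
  induction rs with
  | nil =>
    intro N _ _ _ _ _ hdim
    obtain ⟨s, hs⟩ := exists_pow_smul_eq_zero_of_supportDim_eq_zero N (by simpa using hdim)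
    exact subsingleton_one_of_pow_smul_eq_zero (ModuleCat.of R N) hs
  | cons x rs ih =>
    intro N _ _ _ hmem hreg hdim
    rw [isRegular_cons_iff] at hreg
    have := ih (QuotSMulTop x N) (fun r hr => hmem r (by simp [hr])) hreg.2
      (supportDim_quotSMulTop_of_eq_succ (hmem x (by simp)) hreg.1 hdim)
    exact subsingleton_of_isSMulRegular (hmem x (by simp)) (smul_injective_of_subsingleton hreg.1)

/-- Local cohomology vanishes below the length of a regular sequence. -/
lemma subsingleton_of_lt_length (rs : List R) (N : Type) [AddCommGroup N] [Module R N]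
    [Module.Finite R N] (hmem : ∀ r ∈ rs, r ∈ maximalIdeal R) (hreg : IsRegular N rs)
    (i : ℕ) (hi : i < rs.length) :
    Subsingleton (LimExt (maximalIdeal R) (ModuleCat.of R N) i) := by
  have : Nontrivial N := hreg.nontrivial
  have hvan (t : ℕ) : Subsingleton
      (Ext (ModuleCat.of R (R ⧸ maximalIdeal R ^ t)) (ModuleCat.of R N) i) := by
    refine ModuleCat.subsingleton_ext_of_exists_isRegular (maximalIdeal R) _ ?_ _ ?_ rs hmem
      hreg _ hi
    · change Module.support R (R ⧸ maximalIdeal R ^ t) ⊆ _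
      rw [Module.support_eq_zeroLocus, Ideal.annihilator_quotient]
      intro p hp r hr
      exact p.2.mem_of_pow_mem t (hp (Ideal.pow_mem_pow hr t))
    · exact maximalIdeal_smul_top_lt N
  refine subsingleton_of_forall_eq 0 fun y => ?_
  obtain ⟨t, y, rfl⟩ := Module.DirectLimit.exists_of y
  rw [Subsingleton.elim y 0, map_zero]

/-- The top local cohomology of a Cohen–Macaulay module, modulo a regular element. -/
lemma exists_shortExact (x : R) (rs : List R) (N : Type) [AddCommGroup N] [Module R N]
    [Module.Finite R N] (hmem : ∀ r ∈ x :: rs, r ∈ maximalIdeal R) (hreg : IsRegular N (x :: rs))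
    (hdim : Module.supportDim R N = ((x :: rs).length : WithBot ℕ∞)) :
    ∃ (f : ModuleCat.of R (LimExt (maximalIdeal R) (ModuleCat.of R (QuotSMulTop x N)) rs.length) ⟶
        ModuleCat.of R (LimExt (maximalIdeal R) (ModuleCat.of R N) (rs.length + 1)))
      (w : f ≫ (x • 𝟙 (ModuleCat.of R
        (LimExt (maximalIdeal R) (ModuleCat.of R N) (rs.length + 1)))) = 0),
      (ShortComplex.mk f (x • 𝟙 _) w).ShortExact := by
  have hreg' := (isRegular_cons_iff _ _ _).1 hreg
  have hS := IsSMulRegular.smulShortComplex_shortExact (M := ModuleCat.of R N) hreg'.1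
  have hsub := subsingleton_succ rs (QuotSMulTop x N) (fun r hr => hmem r (by simp [hr])) hreg'.2
    (supportDim_quotSMulTop_of_eq_succ (hmem x (by simp)) hreg'.1 hdim)
  exact exists_shortExact_smul _
    (map_extClass_injective (J := maximalIdeal R) hS rfl
      (subsingleton_of_lt_length (x :: rs) N hmem hreg rs.length (by simp)))
    (exact_map_extClass_smul hreg'.1 _) (smul_surjective_of_subsingleton hreg'.1 _)

/-- The Bass-type lengths of `Ext` into the residue field of the top local cohomology of a
Cohen–Macaulay module are those of the module, shifted by the dimension. -/
lemma length_ext_resMod (rs : List R) : ∀ (N : Type) [AddCommGroup N] [Module R N]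
    [Module.Finite R N], (∀ r ∈ rs, r ∈ maximalIdeal R) → IsRegular N rs →
    Module.supportDim R N = (rs.length : WithBot ℕ∞) →
    (∀ i < rs.length, Module.length R (Ext (ModuleCat.of R
      (LimExt (maximalIdeal R) (ModuleCat.of R N) rs.length)) (resMod R) i) = 0) ∧
    ∀ i, Module.length R (Ext (ModuleCat.of R
      (LimExt (maximalIdeal R) (ModuleCat.of R N) rs.length)) (resMod R) (i + rs.length)) =
      Module.length R (Ext (ModuleCat.of R N) (resMod R) i) := by
  induction rs with
  | nil =>
    intro N _ _ _ _ _ hdim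
    obtain ⟨s, hs⟩ := exists_pow_smul_eq_zero_of_supportDim_eq_zero N (by simpa using hdim)
    obtain ⟨e⟩ := nonempty_equiv_of_pow_smul_eq_zero (J := maximalIdeal R) (ModuleCat.of R N) hs
    refine ⟨by simp, fun i => ?_⟩
    exact (extEquivOfIso e.toModuleIso (resMod R) i).length_eq
  | cons x rs ih =>
    intro N _ _ _ hmem hreg hdim
    obtain ⟨f, w, hL⟩ := exists_shortExact x rs N hmem hreg hdim
    have hreg' := (isRegular_cons_iff _ _ _).1 hreg
    have hx := hmem x (by simp)
    obtain ⟨ih0, ih1⟩ := ih (QuotSMulTop x N) (fun r hr => hmem r (by simp [hr])) hreg'.2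
      (supportDim_quotSMulTop_of_eq_succ hx hreg'.1 hdim)
    have hS := IsSMulRegular.smulShortComplex_shortExact (M := ModuleCat.of R N) hreg'.1
    have hf0 (i) (y : Ext (ModuleCat.of R N) (resMod R) i) :
        (Ext.mk₀ ((ModuleCat.of R N).smulShortComplex x).f).comp y (zero_add i) = 0 := by
      rw [ModuleCat.smulShortComplex_f_eq_smul_id]
      exact smul_id_precomp_ext_resMod hx y
    have hN0 := length_ext_zero_of_precomp_f_eq_zero hS (resMod R) (hf0 0)
    have hN1 := length_ext_of_precomp_f_eq_zero hS (resMod R) hf0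
    let β (i : ℕ) : ℕ∞ := Module.length R (Ext (ModuleCat.of R (LimExt (maximalIdeal R)
      (ModuleCat.of R N) (rs.length + 1))) (resMod R) i)
    have hM (i : ℕ) : Module.length R (Ext (ModuleCat.of R (LimExt (maximalIdeal R)
        (ModuleCat.of R (QuotSMulTop x N)) rs.length)) (resMod R) i) = β i + β (i + 1) :=
      length_ext_of_precomp_g_eq_zero hL (resMod R)
        (fun i y => smul_id_precomp_ext_resMod hx y) i
    have hM0 : β 0 = 0 := Module.length_eq_zero_iff (R := R) |>.2 <|
      show Subsingleton (Ext (ModuleCat.of R (LimExt (maximalIdeal R) (ModuleCat.of R N)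
        (rs.length + 1))) (resMod R) 0) from subsingleton_of_forall_eq 0 fun y => by
      obtain ⟨g, rfl⟩ := (Ext.mk₀_bijective _ _).2 y
      have hy := smul_id_precomp_ext_resMod hx (Ext.mk₀ g)
      have := hL.epi_g
      rw [Ext.mk₀_comp_mk₀, Ext.mk₀_eq_zero_iff] at hy
      rw [Ext.mk₀_eq_zero_iff]
      exact (cancel_epi (x • 𝟙 (ModuleCat.of R (LimExt (maximalIdeal R) (ModuleCat.of R N)
        (rs.length + 1))))).1 (hy.trans Limits.comp_zero.symm)
    have key (i) (hi : i < rs.length + 1) : β i = 0 := by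
      cases i with
      | zero => exact hM0
      | succ i =>
        have h := hM i
        rw [ih0 i (by omega)] at h
        exact (add_eq_zero.1 h.symm).2
    refine ⟨key, fun i => ?_⟩
    induction i with
    | zero =>
      have h := hM rs.length
      rw [key _ (by omega), zero_add] at h
      have h' := ih1 0
      rw [zero_add] at h'
      change β (0 + (rs.length + 1)) = _
      rw [zero_add]
      exact h.symm.trans (h'.trans hN0)
    | succ i ihi =>
      have h := (hM (i + 1 + rs.length)).symm.trans ((ih1 (i + 1)).trans (hN1 i))
      change β (i + (rs.length + 1)) = _ at ihi
      change β (i + 1 + (rs.length + 1)) = _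
      rw [show i + 1 + rs.length = i + (rs.length + 1) by omega, ihi] at h
      rw [show i + 1 + (rs.length + 1) = i + (rs.length + 1) + 1 by omega]
      exact ENat.add_right_injective_of_ne_top (length_ext_resMod_ne_top (ModuleCat.of R N) i) h

end LimExt

end CohenMacaulay

section MinimalCover

open Abelian IsLocalRing TensorProduct

variable {R : Type} [CommRing R]

lemma Ext.comp_mk₀_ofHom_sum {X : ModuleCat.{0} R} {A B : Type} [AddCommGroup A] [Module R A]
    [AddCommGroup B] [Module R B] {ι : Type*} (s : Finset ι) (φ : ι → A →ₗ[R] B) {r : ℕ}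
    (y : Ext X (ModuleCat.of R A) r) :
    y.comp (Ext.mk₀ (ModuleCat.ofHom (∑ i ∈ s, φ i))) (add_zero r) =
      ∑ i ∈ s, y.comp (Ext.mk₀ (ModuleCat.ofHom (φ i))) (add_zero r) := by
  classical
  induction s using Finset.induction_on with
  | empty => simp
  | insert a s ha ih => rw [Finset.sum_insert ha, Finset.sum_insert ha, ModuleCat.ofHom_add,
      Ext.mk₀_add, Ext.comp_add, ih]

lemma ModuleCat.ofHom_smul {A B : Type} [AddCommGroup A] [Module R A] [AddCommGroup B]
    [Module R B] (a : R) (f : A →ₗ[R] B) :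
    ModuleCat.ofHom (a • f) = a • ModuleCat.ofHom f := rfl

lemma LinearMap.eq_sum_smul_single_comp_coord {A ι : Type*} [AddCommGroup A] [Module R A]
    [Fintype ι] {n : ℕ} (φ : A →ₗ[R] (Fin n → R)) (c : Module.Basis ι R A) :
    φ = ∑ p : ι × Fin n,
      φ (c p.1) p.2 • (LinearMap.single R (fun _ : Fin n => R) p.2 ∘ₗ c.coord p.1) := by
  classical
  rw [Fintype.sum_prod_type]
  refine c.ext fun a => ?_
  ext i
  simp [LinearMap.sum_apply, Finset.sum_apply, Finsupp.single_apply, Pi.single_apply]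

lemma subsingleton_ext_pi {X : ModuleCat.{0} R} {r : ℕ} (h : Subsingleton (Ext X (ModuleCat.of R R) r))
    (n : ℕ) : Subsingleton (Ext X (ModuleCat.of R (Fin n → R)) r) := by
  refine subsingleton_of_forall_eq 0 fun y => ?_
  have : (LinearMap.id : (Fin n → R) →ₗ[R] _) =
      ∑ i, LinearMap.single R (fun _ : Fin n => R) i ∘ₗ LinearMap.proj i := by
    refine LinearMap.ext fun v => ?_
    simp [LinearMap.sum_apply, Finset.univ_sum_single]
  rw [← Ext.comp_mk₀_id y]
  change y.comp (Ext.mk₀ (ModuleCat.ofHom LinearMap.id)) _ = 0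
  rw [this, Ext.comp_mk₀_ofHom_sum]
  refine Finset.sum_eq_zero fun i _ => ?_
  rw [ModuleCat.ofHom_comp, ← Ext.mk₀_comp_mk₀, ← Ext.comp_assoc_of_third_deg_zero,
    Subsingleton.elim (y.comp _ _) 0, Ext.zero_comp]

lemma nontrivial_ext_of_free {X : ModuleCat.{0} R} {r : ℕ}
    (h : Nontrivial (Ext X (ModuleCat.of R R) r)) (A : Type) [AddCommGroup A] [Module R A]
    [Module.Free R A] [Nontrivial A] : Nontrivial (Ext X (ModuleCat.of R A) r) := by
  obtain ⟨x, hx⟩ := exists_ne (0 : Ext X (ModuleCat.of R R) r)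
  let c := Module.Free.chooseBasis R A
  obtain ⟨b⟩ := c.index_nonempty
  refine ⟨x.comp (Ext.mk₀ (ModuleCat.ofHom (LinearMap.toSpanSingleton R A (c b)))) (add_zero r), 0,
    fun h0 => hx ?_⟩
  have h1 := congrArg
    (fun z => Ext.comp z (Ext.mk₀ (ModuleCat.ofHom (c.coord b))) (add_zero r)) h0
  have h2 : c.coord b ∘ₗ LinearMap.toSpanSingleton R A (c b) = LinearMap.id := by
    ext; simp
  simp only [Ext.zero_comp, Ext.comp_assoc_of_third_deg_zero, Ext.mk₀_comp_mk₀] at h1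
  rw [← ModuleCat.ofHom_comp, h2] at h1
  exact (Ext.comp_mk₀_id x).symm.trans h1

lemma exists_nontrivial_ext_of_comp_eq_zero {X : ModuleCat.{0} R} {S : ShortComplex (ModuleCat.{0} R)}
    (hS : S.ShortExact) {i : ℕ} {x : Ext X S.X₁ i} (hx : x ≠ 0)
    (h0 : x.comp (Ext.mk₀ S.f) (add_zero i) = 0) : ∃ j < i, Nontrivial (Ext X S.X₃ j) := by
  cases i with
  | zero =>
    have := hS.mono_f
    obtain ⟨g, rfl⟩ := (Ext.mk₀_bijective _ _).2 x
    rw [Ext.mk₀_comp_mk₀, Ext.mk₀_eq_zero_iff] at h0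
    rw [Ne, Ext.mk₀_eq_zero_iff] at hx
    exact absurd ((cancel_mono S.f).1 (h0.trans Limits.zero_comp.symm)) hx
  | succ i =>
    obtain ⟨y, rfl⟩ := Ext.covariant_sequence_exact₁ X hS x h0 rfl
    exact ⟨i, i.lt_succ_self, y, 0, fun h => hx (by rw [h, Ext.zero_comp])⟩

variable [IsLocalRing R]

/-- A finitely generated module over a local ring has a minimal free cover. -/
lemma exists_minimal_cover (N : Type) [AddCommGroup N] [Module R N] [Module.Finite R N] :
    ∃ (n : ℕ) (f : (Fin n → R) →ₗ[R] N), Function.Surjective f ∧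
      ∀ v ∈ LinearMap.ker f, ∀ i, v i ∈ maximalIdeal R := by
  let b := Module.finBasis (ResidueField R) (ResidueField R ⊗[R] N)
  choose v hv using fun i => TensorProduct.mk_surjective R N (ResidueField R)
    residue_surjective (b i)
  refine ⟨_, Fintype.linearCombination R v, ?_, fun w hw i => ?_⟩
  · rw [← LinearMap.range_eq_top, Fintype.range_linearCombination]
    exact span_eq_top_of_tmul_eq_basis v b hv
  · rw [LinearMap.mem_ker, Fintype.linearCombination_apply] at hw
    have h := congrArg (TensorProduct.mk R (ResidueField R) N 1) hw
    rw [map_sum, map_zero] at h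
    rw [← residue_eq_zero_iff]
    refine Fintype.linearIndependent_iff.1 b.linearIndependent (fun i => residue R (w i)) ?_ i
    rw [← h]
    refine Finset.sum_congr rfl fun i _ => ?_
    rw [map_smul, hv, ← ResidueField.algebraMap_eq, algebraMap_smul]

/-- A map from a finite free module with entries in the maximal ideal induces zero on
`Ext` from the residue field. -/
lemma comp_mk₀_eq_zero_of_mem_maximalIdeal {A : Type} [AddCommGroup A] [Module R A]
    [Module.Finite R A] [Module.Free R A] {n : ℕ} (φ : A →ₗ[R] (Fin n → R))
    (hφ : ∀ a i, φ a i ∈ maximalIdeal R) {r : ℕ} (y : Ext (resMod R) (ModuleCat.of R A) r) :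
    y.comp (Ext.mk₀ (ModuleCat.ofHom φ)) (add_zero r) = 0 := by
  rw [LinearMap.eq_sum_smul_single_comp_coord φ (Module.Free.chooseBasis R A),
    Ext.comp_mk₀_ofHom_sum]
  refine Finset.sum_eq_zero fun p _ => ?_
  rw [ModuleCat.ofHom_smul, Ext.mk₀_smul, Ext.comp_smul]
  exact smul_ext_from_resMod (hφ _ _) _

lemma precomp_ker_eq_zero {N : Type} [AddCommGroup N] [Module R N] {n : ℕ}
    {f : (Fin n → R) →ₗ[R] N} (hf : ∀ v ∈ LinearMap.ker f, ∀ i, v i ∈ maximalIdeal R) {j : ℕ}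
    (y : Ext (ModuleCat.of R (Fin n → R)) (resMod R) j) :
    (Ext.mk₀ f.shortComplexKer.f).comp y (zero_add j) = 0 := by
  cases j with
  | zero =>
    obtain ⟨g, rfl⟩ := (Ext.mk₀_bijective _ _).2 y
    refine (Ext.mk₀_comp_mk₀ f.shortComplexKer.f g).trans ?_
    rw [Ext.mk₀_eq_zero_iff]
    refine ModuleCat.hom_ext (LinearMap.ext fun (v : LinearMap.ker f) => ?_)
    change g.hom (v : Fin n → R) = 0
    rw [← Finset.univ_sum_single (v : Fin n → R), map_sum]
    refine Finset.sum_eq_zero fun i _ => ?_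
    have : Pi.single i ((v : Fin n → R) i) = (v : Fin n → R) i • Pi.single (M := fun _ => R) i 1 := by
      rw [← Pi.single_smul, smul_eq_mul, mul_one]
    rw [this, map_smul]
    exact LinearMap.congr_fun (congrArg ModuleCat.Hom.hom (smul_id_resMod (hf v v.2 i))) _
  | succ j =>
    have : Projective (ModuleCat.of R (Fin n → R)) := ModuleCat.projective_of_free (Pi.basisFun R _)
    rw [Ext.eq_zero_of_projective y, Ext.comp_zero]

variable [IsNoetherianRing R]

lemma free_or_exists_nontrivial_ext {r : ℕ}
    (hr : ∀ i < r, Subsingleton (Ext (resMod R) (ModuleCat.of R R) i))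
    (hr' : Nontrivial (Ext (resMod R) (ModuleCat.of R R) r)) (j : ℕ) :
    ∀ (N : Type) [AddCommGroup N] [Module R N] [Module.Finite R N],
      Subsingleton (Ext (ModuleCat.of R N) (resMod R) j) →
      Module.Free R N ∨ ∃ i < r, Nontrivial (Ext (resMod R) (ModuleCat.of R N) i) := by
  induction j with
  | zero =>
    intro N _ _ _ hN
    obtain ⟨n, f, hf, hm⟩ := exists_minimal_cover (R := R) N
    have hS := LinearMap.shortExact_shortComplexKer hf
    cases n with
    | zero =>
      have := hf.subsingleton
      exact .inl inferInstance
    | succ n =>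
      exfalso
      let g : ModuleCat.of R (Fin (n + 1) → R) ⟶ resMod R :=
        ModuleCat.ofHom (Algebra.linearMap R (ResidueField R) ∘ₗ LinearMap.proj 0)
      obtain ⟨y, hy⟩ := Ext.contravariant_sequence_exact₂ hS (resMod R) (Ext.mk₀ g)
        (precomp_ker_eq_zero hm _)
      have : y = 0 := hN.elim _ _
      rw [this, Ext.comp_zero, eq_comm, Ext.mk₀_eq_zero_iff] at hy
      have h1 : algebraMap R (ResidueField R) 1 = 0 :=
        LinearMap.congr_fun (congrArg ModuleCat.Hom.hom hy) (fun _ => 1)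
      simp at h1
  | succ j ih =>
    intro N _ _ _ hN
    obtain ⟨n, f, hf, hm⟩ := exists_minimal_cover (R := R) N
    have hS := LinearMap.shortExact_shortComplexKer hf
    have hK : Subsingleton (Ext (ModuleCat.of R (LinearMap.ker f)) (resMod R) j) := by
      refine subsingleton_of_forall_eq 0 fun y => ?_
      obtain ⟨z, rfl⟩ := Ext.contravariant_sequence_exact₁ hS (resMod R) y (add_comm 1 j)
        (hN.elim _ _)
      exact precomp_ker_eq_zero hm z
    rcases subsingleton_or_nontrivial (LinearMap.ker f) with h | h
    · rw [Submodule.subsingleton_iff_eq_bot, LinearMap.ker_eq_bot] at h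
      exact .inl (.of_equiv (LinearEquiv.ofBijective f ⟨h, hf⟩))
    right
    rcases ih (LinearMap.ker f) hK with h | ⟨i, hi, h⟩
    · obtain ⟨x, hx⟩ := @exists_ne _ (nontrivial_ext_of_free hr' (LinearMap.ker f)) 0
      exact exists_nontrivial_ext_of_comp_eq_zero hS hx
        (comp_mk₀_eq_zero_of_mem_maximalIdeal (LinearMap.ker f).subtype (fun a => hm a a.2) x)
    · obtain ⟨x, hx⟩ := exists_ne (0 : Ext (resMod R) (ModuleCat.of R (LinearMap.ker f)) i)
      obtain ⟨j, hj, h'⟩ := exists_nontrivial_ext_of_comp_eq_zero hS hx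
        ((subsingleton_ext_pi (hr i hi) n).elim _ _)
      exact ⟨j, hj.trans hi, h'⟩

/-- If `depth R < depth N`, then no `Ext` from `N` to the residue field vanishes. -/
theorem nontrivial_ext_resMod_of_depth_lt {r : ℕ}
    (hr : Nontrivial (Ext (resMod R) (ModuleCat.of R R) r))
    (N : Type) [AddCommGroup N] [Module R N] [Module.Finite R N] [Nontrivial N]
    (hN : ∀ i ≤ r, Subsingleton (Ext (resMod R) (ModuleCat.of R N) i)) (j : ℕ) :
    Nontrivial (Ext (ModuleCat.of R N) (resMod R) j) := by
  classical
  have hex : ∃ r, Nontrivial (Ext (resMod R) (ModuleCat.of R R) r) := ⟨r, hr⟩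
  have hle : Nat.find hex ≤ r := Nat.find_min' hex hr
  by_contra hj
  rw [not_nontrivial_iff_subsingleton] at hj
  rcases free_or_exists_nontrivial_ext
    (fun i hi => not_nontrivial_iff_subsingleton.1 (Nat.find_min hex hi)) (Nat.find_spec hex) j N hj
    with h | ⟨i, hi, h⟩
  · exact not_nontrivial_iff_subsingleton.2 (hN _ hle)
      (nontrivial_ext_of_free (Nat.find_spec hex) N)
  · exact not_nontrivial_iff_subsingleton.2 (hN i (hi.le.trans hle)) h

end MinimalCover

section TopLocalCohomology

open Abelian IsLocalRing

variable {R : Type} [CommRing R]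

lemma nontrivial_extModule_iff (n : ℕ) (X M : ModuleCat.{0} R) :
    Nontrivial (extModule R n X M) ↔ Nontrivial (Ext X M n) :=
  ((projectiveResolution X).extComparison M n).toEquiv.nontrivial_congr

lemma subsingleton_ext_of_lt_edepth {X M : ModuleCat.{0} R} {i : ℕ}
    (h : (i : EReal) < edepth R X M) : Subsingleton (Ext X M i) := by
  by_contra hn
  rw [not_subsingleton_iff_nontrivial, ← nontrivial_extModule_iff] at hn
  exact h.not_ge (sInf_le ⟨i, rfl, hn⟩)

lemma exists_nontrivial_ext_of_edepth_lt {X M : ModuleCat.{0} R} {d : ℕ}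
    (h : edepth R X M < (d : EReal)) : ∃ r < d, Nontrivial (Ext X M r) := by
  obtain ⟨_, ⟨r, rfl, hr⟩, hlt⟩ := sInf_lt_iff.1 h
  exact ⟨r, by exact_mod_cast hlt, (nontrivial_extModule_iff _ _ _).1 hr⟩

variable [IsLocalRing R] [IsNoetherianRing R]

lemma exists_isRegular_length_eq (N : Type) [AddCommGroup N] [Module R N] [Module.Finite R N]
    [Nontrivial N] {d : ℕ}
    (h : ∀ i < d, Subsingleton (Ext (resMod R) (ModuleCat.of R N) i)) :
    ∃ rs : List R, rs.length = d ∧ (∀ r ∈ rs, r ∈ maximalIdeal R) ∧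
      RingTheory.Sequence.IsRegular N rs := by
  refine ModuleCat.exists_isRegular_of_exists_subsingleton_ext (maximalIdeal R) d
    (ModuleCat.of R N) (maximalIdeal_smul_top_lt N) (resMod R) ?_ h
  rw [Module.support_eq_zeroLocus]
  change PrimeSpectrum.zeroLocus (Module.annihilator R (R ⧸ maximalIdeal R) : Set R) = _
  rw [Ideal.annihilator_quotient]

theorem nontrivial_ext_localCohomology_resMod (N : Type) [AddCommGroup N] [Module R N]
    [Module.Finite R N] {d r : ℕ}
    (hN : ∀ i < d, Subsingleton (Ext (resMod R) (ModuleCat.of R N) i))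
    (hdim : Module.supportDim R N = (d : WithBot ℕ∞))
    (hrd : r < d) (hr : Nontrivial (Ext (resMod R) (ModuleCat.of R R) r)) (i : ℕ) (hi : d ≤ i) :
    Nontrivial (Ext ((localCohomology (maximalIdeal R) d).obj (ModuleCat.of R N))
      (resMod R) i) := by
  have : Nontrivial N := by
    rw [← Module.supportDim_ne_bot_iff_nontrivial R, hdim]
    exact WithBot.coe_ne_bot
  obtain ⟨rs, rfl, hmem, hreg⟩ := exists_isRegular_length_eq N hN
  obtain ⟨j, rfl⟩ := Nat.exists_eq_add_of_le' hi
  have h := (LimExt.length_ext_resMod rs N hmem hreg hdim).2 j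
  have hj := nontrivial_ext_resMod_of_depth_lt hr N
    (fun i hi => hN i (hi.trans_lt hrd)) j
  have hL : Nontrivial (Ext (ModuleCat.of R (LimExt (maximalIdeal R) (ModuleCat.of R N) rs.length))
      (resMod R) (j + rs.length)) := by
    rw [← Module.length_pos_iff (R := R)] at hj ⊢
    rwa [h]
  exact (extEquivOfIso (limExtEquivLocalCohomology (maximalIdeal R) (ModuleCat.of R N)
    rs.length).toModuleIso (resMod R) _).toEquiv.nontrivial_congr.1 hL

end TopLocalCohomology

/-- `(R, m, k)` local noetherian, `N` finitely generated Cohen–Macaulay of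
dimension `d` with `d > depth R`, `M := H^d_m(N)`. Then `Tor_i^R(k, M) ≠ 0` for all
`i ≥ d`; in particular the flat dimension of `M` is infinite. -/
theorem tor_nonvanishing_of_top_localCohomology_CM
    (R : Type) [CommRing R] [IsNoetherianRing R] [IsLocalRing R]
    (N : Type) [AddCommGroup N] [Module R N] [Module.Finite R N] (d : ℕ)
    (hdepth : edepth R (ModuleCat.of R (IsLocalRing.ResidueField R)) (ModuleCat.of R N)
      = (d : EReal))
    (hdim : Order.krullDim (Module.support R N) = (d : WithBot ℕ∞))
    (hgt : edepth R (ModuleCat.of R (IsLocalRing.ResidueField R)) (ModuleCat.of R R)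
      < (d : EReal)) :
    (∀ i : ℕ, d ≤ i → Nontrivial
      (torModule R i (ModuleCat.of R (IsLocalRing.ResidueField R))
        ((localCohomology (IsLocalRing.maximalIdeal R) d).obj (ModuleCat.of R N)))) ∧
    ¬ ∃ n : ℕ, ∀ (X : ModuleCat R) (i : ℕ), n ≤ i →
        Subsingleton (torModule R i X
          ((localCohomology (IsLocalRing.maximalIdeal R) d).obj (ModuleCat.of R N))) := by
  obtain ⟨r, hrd, hr⟩ := exists_nontrivial_ext_of_edepth_lt hgt
  have key (i : ℕ) (hi : d ≤ i) : Nontrivial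
      (torModule R i (ModuleCat.of R (IsLocalRing.ResidueField R))
        ((localCohomology (IsLocalRing.maximalIdeal R) d).obj (ModuleCat.of R N))) := by
    have := nontrivial_ext_localCohomology_resMod N (fun i hi => subsingleton_ext_of_lt_edepth
      (by rw [hdepth]; exact_mod_cast hi)) hdim hrd hr i hi
    exact nontrivial_tor_of_nontrivial_ext (IsLocalRing.ResidueField R) _ i
  refine ⟨key, fun ⟨n, h⟩ => ?_⟩
  exact not_nontrivial_iff_subsingleton.2 (h _ (max n d) (le_max_left _ _))
    (key _ (le_max_right _ _))
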